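/- arXiv:2503.15032 — 2 statements merged into one kernel-verified Lean document; each statement's English description precedes it below -/
import Mathlib

section
/- For every integer n ≥ 1 and every integer j ≥ 0, the number of increasing 1,2-trees on the vertex set {1,…,n} having exactly (n−1)+j edges equals the number of Cayley trees on the vertex set {1,…,n} having exactly j twists. -/
open SimpleGraph

/-- The set of neighbors of `v` having a smaller label. -/
def lowerNbrs {n : ℕ} (G : SimpleGraph (Fin n)) (v : Fin n) : Set (Fin n) :=
  {x | G.Adj v x ∧ x < v}

/-- `G` is an increasing 1,2-tree: every vertex other than the first one has a nonempty
set of smaller neighbors, of cardinality at most 2, forming a clique. -/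
def IsIncreasing12Tree {n : ℕ} (G : SimpleGraph (Fin n)) : Prop :=
  ∀ v : Fin n, 1 ≤ v.val →
    (lowerNbrs G v).Nonempty ∧ (lowerNbrs G v).ncard ≤ 2 ∧
      ∀ x ∈ lowerNbrs G v, ∀ y ∈ lowerNbrs G v, x ≠ y → G.Adj x y

/-- The set of vertices reachable from `v` after deleting the edge `{u,v}`
(in a tree, the vertex set of the subtree rooted at `v` when `v` is the child endpoint). -/
def subtreeSet {n : ℕ} (G : SimpleGraph (Fin n)) (u v : Fin n) : Set (Fin n) :=
  {w | (G.deleteEdges {s(u, v)}).Reachable v w}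

/-- `v` is the child endpoint of the edge `{u,v}`: after deleting this edge,
`v` is no longer reachable from the root. -/
def IsChild {n : ℕ} (G : SimpleGraph (Fin n)) (root u v : Fin n) : Prop :=
  G.Adj u v ∧ ¬ (G.deleteEdges {s(u, v)}).Reachable root v

/-- The minimal label occurring in a set of vertices (labels being `Fin.val`). -/
noncomputable def minLabel {n : ℕ} (S : Set (Fin n)) : ℕ := sInf (Fin.val '' S)

/-- An edge `{u,v}` with child endpoint `v` is a twist if the minimal label in the
subtree rooted at `v` is smaller than the label of `u`. -/
def IsTwist {n : ℕ} (G : SimpleGraph (Fin n)) (root : Fin n) (e : Sym2 (Fin n)) : Prop :=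
  ∃ u v : Fin n, e = s(u, v) ∧ IsChild G root u v ∧ minLabel (subtreeSet G u v) < u.val

/-- An edge `{u,v}` with child endpoint `v` is increasing if the label of `u` is smaller
than every label in the subtree rooted at `v`. -/
def IsIncreasingEdge {n : ℕ} (G : SimpleGraph (Fin n)) (root : Fin n) (e : Sym2 (Fin n)) : Prop :=
  ∃ u v : Fin n, e = s(u, v) ∧ IsChild G root u v ∧ u.val < minLabel (subtreeSet G u v)

/-- The number of twists of `G` (with respect to the given root). -/
noncomputable def numTwists {n : ℕ} (G : SimpleGraph (Fin n)) (root : Fin n) : ℕ :=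
  Nat.card {e : Sym2 (Fin n) // e ∈ G.edgeSet ∧ IsTwist G root e}

/-- The number of increasing 1,2-trees on `n` vertices with `m` edges. -/
noncomputable def numInc12Trees (n m : ℕ) : ℕ :=
  Nat.card {G : SimpleGraph (Fin n) // IsIncreasing12Tree G ∧ G.edgeSet.ncard = m}

/-- The number of Cayley trees on `n ≥ 1` vertices (rooted at the vertex with label 1)
with exactly `j` twists. -/
noncomputable def numCayleyTwist (n j : ℕ) (h : 0 < n) : ℕ :=
  Nat.card {G : SimpleGraph (Fin n) // G.IsTree ∧ numTwists G ⟨0, h⟩ = j}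

/-- `Desc p v w` says that `v` lies on the orbit `w, p w, p (p w), …`, that is,
`w` is a descendant of `v` for the parent function `p`. -/
inductive Desc (p : ℕ → ℕ) (v : ℕ) : ℕ → Prop
  | refl : Desc p v v
  | step {w : ℕ} : Desc p v (p w) → Desc p v w

/-- Parent functions of trees on `{0, …, n - 1}` rooted at `0`, extended by `0`. -/
structure IsParent (n : ℕ) (p : ℕ → ℕ) : Prop where
  zero : p 0 = 0
  lt : ∀ v, p v < n
  out : ∀ v, n ≤ v → p v = 0
  rank : ∃ d : ℕ → ℕ, ∀ v, v ≠ 0 → d (p v) < d v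

/-- The smallest descendant of `v`. -/
noncomputable def minDesc (p : ℕ → ℕ) (v : ℕ) : ℕ := sInf {w | Desc p v w}

/-- The non-root vertices whose edge to the parent is a twist. -/
def twistSet (p : ℕ → ℕ) : Set ℕ := {v | minDesc p v < p v}

theorem desc_minDesc (p : ℕ → ℕ) (v : ℕ) : Desc p v (minDesc p v) :=
  Nat.sInf_mem (s := {w | Desc p v w}) ⟨v, Desc.refl⟩

theorem Desc.minDesc_le {p : ℕ → ℕ} {v w : ℕ} (h : Desc p v w) : minDesc p v ≤ w :=
  Nat.sInf_le (s := {w | Desc p v w}) h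

theorem minDesc_le_self (p : ℕ → ℕ) (v : ℕ) : minDesc p v ≤ v := Desc.refl.minDesc_le

theorem Desc.trans {p : ℕ → ℕ} {u v w : ℕ} (huv : Desc p u v) (hvw : Desc p v w) :
    Desc p u w := by
  induction hvw with
  | refl => exact huv
  | step _ ih => exact ih.step

theorem minDesc_le_of_parent {p : ℕ → ℕ} {u x : ℕ} (h : p x = u) : minDesc p u ≤ minDesc p x :=
  ((Desc.step (h ▸ Desc.refl)).trans (desc_minDesc p x)).minDesc_le

theorem Desc.cases_parent {p : ℕ → ℕ} {v w : ℕ} (h : Desc p v w) : w = v ∨ Desc p v (p w) := by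
  cases h with
  | refl => exact Or.inl rfl
  | step h => exact Or.inr h

theorem Desc.comparable {p : ℕ → ℕ} {a b w : ℕ} (ha : Desc p a w) (hb : Desc p b w) :
    Desc p a b ∨ Desc p b a := by
  induction ha with
  | refl => exact Or.inr hb
  | step ha ih =>
    rcases hb.cases_parent with rfl | hb
    · exact Or.inl ha.step
    · exact ih hb

theorem IsParent.desc_zero {n : ℕ} {p : ℕ → ℕ} (hp : IsParent n p) {v w : ℕ} (h : Desc p v w)
    (hw : w = 0) : v = 0 := by
  induction h with
  | refl => exact hw
  | step _ ih => exact ih (by rw [hw, hp.zero])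

theorem IsParent.rank_le {n : ℕ} {p : ℕ → ℕ} (hp : IsParent n p) {d : ℕ → ℕ}
    (hd : ∀ v, v ≠ 0 → d (p v) < d v) {v w : ℕ} (h : Desc p v w) : d v ≤ d w := by
  induction h with
  | refl => exact le_rfl
  | @step w _ ih =>
    by_cases hw : w = 0
    · rwa [hw, hp.zero, ← hw] at ih
    · exact ih.trans (hd w hw).le

theorem IsParent.zero_desc {n : ℕ} {p : ℕ → ℕ} (hp : IsParent n p) (v : ℕ) : Desc p 0 v := by
  obtain ⟨d, hd⟩ := hp.rank
  induction h : d v using Nat.strong_induction_on generalizing v with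
  | _ k ih =>
    by_cases hv : v = 0
    · exact hv ▸ Desc.refl
    · exact (ih _ (h ▸ hd v hv) _ rfl).step

theorem IsParent.not_desc_parent {n : ℕ} {p : ℕ → ℕ} (hp : IsParent n p) {v : ℕ} (hv : v ≠ 0) :
    ¬ Desc p v (p v) := by
  obtain ⟨d, hd⟩ := hp.rank
  exact fun h => (hd v hv).not_ge (hp.rank_le hd h)

theorem IsParent.ne_parent {n : ℕ} {p : ℕ → ℕ} (hp : IsParent n p) {v : ℕ} (hv : v ≠ 0) :
    p v ≠ v := fun h => hp.not_desc_parent hv (h.symm ▸ Desc.refl)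

theorem IsParent.desc_lt {n : ℕ} {p : ℕ → ℕ} (hp : IsParent n p) {v w : ℕ} (h : Desc p v w)
    (hv : v ≠ 0) (hvn : v < n) : w < n := by
  by_contra hw
  rcases h.cases_parent with rfl | h
  · exact hw hvn
  · exact hv (hp.desc_zero h (hp.out w (not_lt.1 hw)))

/-- Distinct siblings have distinct smallest descendants. -/
theorem IsParent.sibling_inj {n : ℕ} {p : ℕ → ℕ} (hp : IsParent n p) {a b : ℕ} (ha : a ≠ 0)
    (hb : b ≠ 0) (hab : p a = p b) (h : minDesc p a = minDesc p b) : a = b := by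
  have hA := desc_minDesc p a
  rw [h] at hA
  rcases hA.comparable (desc_minDesc p b) with h' | h'
  · rcases h'.cases_parent with h' | h'
    · exact h'.symm
    · exact absurd (hab ▸ h') (hp.not_desc_parent ha)
  · rcases h'.cases_parent with h' | h'
    · exact h'
    · exact absurd (hab ▸ h') (hp.not_desc_parent hb)

theorem IsParent.twistSet_subset {n : ℕ} {p : ℕ → ℕ} (hp : IsParent n p) {v : ℕ}
    (hv : v ∈ twistSet p) : v ≠ 0 ∧ v < n ∧ p v ≠ 0 := by
  have h : p v ≠ 0 := fun h => by simp [twistSet, h] at hv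
  refine ⟨fun h0 => h (h0 ▸ hp.zero), ?_, h⟩
  by_contra hn
  exact h (hp.out v (not_lt.1 hn))

theorem IsParent.finite_twistSet {n : ℕ} {p : ℕ → ℕ} (hp : IsParent n p) :
    (twistSet p).Finite :=
  (Set.finite_Iio n).subset fun _ hv => (hp.twistSet_subset hv).2.1

/-- Attach the new vertex `n` as a leaf below `u`. -/
def addLeaf (p : ℕ → ℕ) (n u : ℕ) : ℕ → ℕ := Function.update p n u

theorem addLeaf_of_ne (p : ℕ → ℕ) {n x : ℕ} (u : ℕ) (hx : x ≠ n) : addLeaf p n u x = p x :=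
  Function.update_of_ne hx _ _

theorem addLeaf_self (p : ℕ → ℕ) (n u : ℕ) : addLeaf p n u n = u := Function.update_self _ _ _

theorem isParent_addLeaf {n : ℕ} {p : ℕ → ℕ} (hp : IsParent n p) {u : ℕ} (hu : u < n) :
    IsParent (n + 1) (addLeaf p n u) := by
  have hlt : ∀ v, p v < n := hp.lt
  refine ⟨?_, fun v => ?_, fun v hv => ?_, ?_⟩
  · rw [addLeaf_of_ne _ _ (by omega), hp.zero]
  · by_cases h : v = n
    · rw [h, addLeaf_self]; omega
    · rw [addLeaf_of_ne _ _ h]; have := hlt v; omega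
  · rw [addLeaf_of_ne _ _ (by omega), hp.out v (by omega)]
  · obtain ⟨d, hd⟩ := hp.rank
    refine ⟨Function.update d n (d u + 1), fun v hv => ?_⟩
    by_cases h : v = n
    · rw [h, addLeaf_self, Function.update_self, Function.update_of_ne (by omega)]; omega
    · rw [addLeaf_of_ne _ _ h, Function.update_of_ne h,
        Function.update_of_ne (by have := hlt v; omega)]
      exact hd v hv

theorem minDesc_addLeaf {n : ℕ} {p : ℕ → ℕ} (hp : IsParent n p) {u x : ℕ}
    (hx : x < n) : minDesc (addLeaf p n u) x = minDesc p x := by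
  apply le_antisymm
  · have key : ∀ w, Desc p x w → w < n → Desc (addLeaf p n u) x w := by
      intro w h
      induction h with
      | refl => exact fun _ => Desc.refl
      | @step w _ ih =>
        intro hw
        exact Desc.step (by rw [addLeaf_of_ne _ _ hw.ne]; exact ih (hp.lt w))
    exact (key _ (desc_minDesc p x) ((minDesc_le_self p x).trans_lt hx)).minDesc_le
  · have key : ∀ w, Desc (addLeaf p n u) x w → w < n → Desc p x w := by
      intro w h
      induction h with
      | refl => exact fun _ => Desc.refl
      | @step w _ ih =>
        intro hw
        rw [addLeaf_of_ne _ _ hw.ne] at ih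
        exact Desc.step (ih (hp.lt w))
    exact (key _ (desc_minDesc _ x) ((minDesc_le_self _ x).trans_lt hx)).minDesc_le

theorem twistSet_addLeaf {n : ℕ} {p : ℕ → ℕ} (hp : IsParent n p) {u : ℕ} (hu : u < n) :
    twistSet (addLeaf p n u) = twistSet p := by
  ext x
  simp only [twistSet, Set.mem_ofPred_eq]
  rcases lt_trichotomy x n with h | rfl | h
  · rw [minDesc_addLeaf hp h, addLeaf_of_ne _ _ h.ne]
  · rw [addLeaf_self, hp.out x le_rfl]
    refine iff_of_false (fun h => ?_) (Nat.not_lt_zero _)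
    rcases (desc_minDesc (addLeaf p x u) x).cases_parent with h' | h'
    · omega
    · have h0 := ((isParent_addLeaf hp hu).desc_lt h' (by omega) (by omega))
      have key : ∀ w, Desc (addLeaf p x u) x w → x ≤ w := by
        intro w hw
        induction hw with
        | refl => exact le_rfl
        | @step w _ ih =>
          by_cases hwx : w = x
          · exact hwx.ge
          · rw [addLeaf_of_ne _ _ hwx] at ih
            exact absurd ih (hp.lt w).not_ge
      have := key _ (desc_minDesc _ x)
      omega
  · rw [addLeaf_of_ne _ _ h.ne', hp.out x h.le]
    simp

/-- Insert the new vertex `n` above `u`, moving the vertices of `M` below `n`. -/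
noncomputable def insertAbove (p : ℕ → ℕ) (n u : ℕ) (M : Set ℕ) (x : ℕ) : ℕ :=
  open Classical in if x = n then p u else if x = u ∨ x ∈ M then n else p x

section insertAbove

variable {n u : ℕ} {p : ℕ → ℕ} {M : Set ℕ}

theorem insertAbove_new (p : ℕ → ℕ) (n u : ℕ) (M : Set ℕ) : insertAbove p n u M n = p u := by
  simp [insertAbove]

theorem insertAbove_base (p : ℕ → ℕ) (M : Set ℕ) (hu : u < n) : insertAbove p n u M u = n := by
  simp [insertAbove, hu.ne]

theorem insertAbove_moved (p : ℕ → ℕ) (u : ℕ) {x : ℕ} (hx : x ∈ M) (hn : x < n) :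
    insertAbove p n u M x = n := by
  simp [insertAbove, hn.ne, hx]

theorem insertAbove_of_not_mem (p : ℕ → ℕ) {x : ℕ} (hn : x ≠ n) (hu : x ≠ u) (hM : x ∉ M) :
    insertAbove p n u M x = p x := by
  simp [insertAbove, hn, hM, hu]

theorem IsParent.lt_of_parent_ne_zero (hp : IsParent n p) {x : ℕ} (h : p x ≠ 0) : x < n := by
  by_contra hx
  exact h (hp.out x (not_lt.1 hx))

theorem insertAbove_eq_iff (hp : IsParent n p) (hu : u < n)
    (hM : ∀ x ∈ M, x < n) {x : ℕ} :
    insertAbove p n u M x = n ↔ x = u ∨ x ∈ M := by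
  by_cases hn : x = n
  · subst hn
    rw [insertAbove_new]
    refine iff_of_false (hp.lt u).ne ?_
    rintro (h | h)
    · exact hu.ne h.symm
    · exact (hM _ h).ne rfl
  · by_cases h : x = u ∨ x ∈ M
    · simp [insertAbove, hn, h]
    · simp [insertAbove, hn, h, (hp.lt x).ne]

theorem isParent_insertAbove (hp : IsParent n p) (hu0 : u ≠ 0) (hu : u < n)
    (hM : ∀ x ∈ M, p x = u) : IsParent (n + 1) (insertAbove p n u M) := by
  have hMlt : ∀ x ∈ M, x < n := fun x hx => hp.lt_of_parent_ne_zero (by rw [hM x hx]; exact hu0)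
  have h0M : 0 ∉ M := fun h => hu0 (by rw [← hM 0 h, hp.zero])
  have hle : ∀ v, insertAbove p n u M v < n + 1 := by
    intro v
    have := hp.lt u
    have := hp.lt v
    unfold insertAbove
    split_ifs <;> omega
  refine ⟨?_, hle, fun v hv => ?_, ?_⟩
  · rw [insertAbove_of_not_mem _ (by omega) hu0.symm h0M, hp.zero]
  · rw [insertAbove_of_not_mem _ (by omega) (by omega)
      (fun h => by have := hMlt v h; omega), hp.out v (by omega)]
  · obtain ⟨d, hd⟩ := hp.rank
    have hdu := hd u hu0
    refine ⟨fun x => if x = n then 2 * d u - 1 else 2 * d x, fun v hv => ?_⟩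
    have hvd := hd v hv
    have h1 := (hp.lt v).ne
    have h2 := (hp.lt u).ne
    by_cases hvn : v = n
    · subst hvn
      rw [insertAbove_new]
      simp only [h2, if_false, if_true]
      omega
    · by_cases hvu : v = u
      · subst hvu
        rw [insertAbove_base _ _ hu]
        simp only [hvn, if_false, if_true]
        omega
      · by_cases hvM : v ∈ M
        · rw [insertAbove_moved _ _ hvM (hMlt v hvM)]
          simp only [hvn, if_false, if_true]
          rw [hM v hvM] at hvd
          omega
        · rw [insertAbove_of_not_mem _ hvn hvu hvM]
          simp only [hvn, h1, if_false]
          omega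

theorem desc_of_desc_insertAbove (hp : IsParent n p) (hu : u < n)
    (hM : ∀ x ∈ M, p x = u) {x y : ℕ}
    (hxy : y < n ∧ x = y ∨ y = u ∧ x = n) {w : ℕ} (h : Desc (insertAbove p n u M) x w) :
    (w = n → Desc p y u) ∧ (w < n → Desc p y w) := by
  induction h with
  | refl =>
    rcases hxy with ⟨h1, rfl⟩ | ⟨rfl, rfl⟩
    · exact ⟨fun h => absurd h h1.ne, fun _ => Desc.refl⟩
    · exact ⟨fun _ => Desc.refl, fun h => absurd h (lt_irrefl _)⟩
  | @step w _ ih =>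
    refine ⟨?_, fun hw => ?_⟩
    · rintro rfl
      rw [insertAbove_new] at ih
      exact (ih.2 (hp.lt u)).step
    · by_cases hwu : w = u
      · subst hwu
        rw [insertAbove_base _ _ hu] at ih
        exact ih.1 rfl
      · by_cases hwM : w ∈ M
        · rw [insertAbove_moved _ _ hwM hw] at ih
          exact Desc.step (by rw [hM w hwM]; exact ih.1 rfl)
        · rw [insertAbove_of_not_mem _ hw.ne hwu hwM] at ih
          exact (ih.2 (hp.lt w)).step

theorem desc_insertAbove (hp : IsParent n p) (hu : u < n)
    (hM : ∀ x ∈ M, p x = u) {x w : ℕ} (hxu : x ≠ u) (h : Desc p x w) (hw : w < n) :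
    Desc (insertAbove p n u M) x w := by
  induction h with
  | refl => exact Desc.refl
  | @step w _ ih =>
    have ih := ih (hp.lt w)
    by_cases hwu : w = u
    · subst hwu
      refine Desc.step ?_
      rw [insertAbove_base _ _ hu]
      refine Desc.step ?_
      rwa [insertAbove_new]
    · by_cases hwM : w ∈ M
      · rw [hM w hwM] at ih
        rcases ih.cases_parent with h | h
        · exact absurd h.symm hxu
        · refine Desc.step ?_
          rw [insertAbove_moved _ _ hwM hw]
          rwa [insertAbove_base _ _ hu] at h
      · exact Desc.step (by rwa [insertAbove_of_not_mem _ hw.ne hwu hwM])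

theorem desc_insertAbove_new (hp : IsParent n p) (hu : u < n)
    {w : ℕ} (h : Desc p u w) (hw : w < n) :
    Desc (insertAbove p n u M) n w := by
  induction h with
  | refl => exact Desc.step (by rw [insertAbove_base _ _ hu]; exact Desc.refl)
  | @step w _ ih =>
    by_cases hwu : w = u
    · subst hwu
      exact Desc.step (by rw [insertAbove_base _ _ hu]; exact Desc.refl)
    · by_cases hwM : w ∈ M
      · exact Desc.step (by rw [insertAbove_moved _ _ hwM hw]; exact Desc.refl)
      · exact Desc.step (by rw [insertAbove_of_not_mem _ hw.ne hwu hwM]; exact ih (hp.lt w))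

theorem minDesc_insertAbove (hp : IsParent n p) (hu : u < n)
    (hM : ∀ x ∈ M, p x = u) {x : ℕ} (hxu : x ≠ u) (hx : x < n) :
    minDesc (insertAbove p n u M) x = minDesc p x := by
  apply le_antisymm
  · exact (desc_insertAbove hp hu hM hxu (desc_minDesc p x)
      ((minDesc_le_self p x).trans_lt hx)).minDesc_le
  · exact ((desc_of_desc_insertAbove hp hu hM (Or.inl ⟨hx, rfl⟩) (desc_minDesc _ x)).2
      ((minDesc_le_self _ x).trans_lt hx)).minDesc_le

theorem minDesc_insertAbove_new (hp : IsParent n p) (hu : u < n)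
    (hM : ∀ x ∈ M, p x = u) :
    minDesc (insertAbove p n u M) n = minDesc p u := by
  have h1 : minDesc p u < n := (minDesc_le_self p u).trans_lt hu
  have h2 : minDesc (insertAbove p n u M) n ≤ minDesc p u :=
    (desc_insertAbove_new hp hu (desc_minDesc p u) h1).minDesc_le
  exact h2.antisymm ((desc_of_desc_insertAbove hp hu hM (Or.inr ⟨rfl, rfl⟩)
    (desc_minDesc _ n)).2 (h2.trans_lt h1)).minDesc_le

theorem desc_insertAbove_base (hp : IsParent n p) (hu0 : u ≠ 0) (hu : u < n)
    {w : ℕ} (h : Desc (insertAbove p n u M) u w) :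
    w = u ∨ ∃ c, p c = u ∧ c ∉ M ∧ Desc p c w := by
  have key : ∀ c, p c = u → ¬ Desc p c (p u) := fun c hc h =>
    hp.not_desc_parent hu0 ((Desc.step (hc ▸ Desc.refl)).trans h)
  have keyn : ∀ c, p c = u → ¬ Desc p c n := by
    intro c hc h
    have hcn := hp.lt_of_parent_ne_zero (hc ▸ hu0 : p c ≠ 0)
    exact (hp.desc_lt h (fun h0 => hu0 (by rw [← hc, h0, hp.zero])) hcn).ne rfl
  induction h with
  | refl => exact Or.inl rfl
  | @step w _ ih =>
    by_cases hwu : w = u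
    · exact Or.inl hwu
    · by_cases hwn : w = n
      · subst hwn
        rw [insertAbove_new] at ih
        rcases ih with h | ⟨c, hc, -, h⟩
        · exact absurd h (hp.ne_parent hu0)
        · exact absurd h (key c hc)
      · by_cases hwM : w ∈ M
        · have hq : insertAbove p n u M w = n := by simp [insertAbove, hwn, hwM]
          rw [hq] at ih
          rcases ih with h | ⟨c, hc, -, h⟩
          · exact absurd h hu.ne'
          · exact absurd h (keyn c hc)
        · rw [insertAbove_of_not_mem _ hwn hwu hwM] at ih
          rcases ih with h | ⟨c, hc, hcM, h⟩
          · exact Or.inr ⟨w, h, hwM, Desc.refl⟩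
          · exact Or.inr ⟨c, hc, hcM, h.step⟩

/-- `M` is a set of twist children of `u`, closed under passing to children of `u` with
a smaller smallest descendant. -/
structure Movable (p : ℕ → ℕ) (u : ℕ) (M : Set ℕ) : Prop where
  parent : ∀ x ∈ M, p x = u
  twist : ∀ x ∈ M, minDesc p x < u
  down : ∀ x ∈ M, ∀ y, p y = u → minDesc p y ≤ minDesc p x → y ∈ M

theorem Movable.minDesc_lt (hp : IsParent n p) (hu0 : u ≠ 0) (hu : u < n) (hM : Movable p u M)
    {x : ℕ} (hx : x ∈ M) :
    minDesc (insertAbove p n u M) x < minDesc (insertAbove p n u M) u := by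
  have hxn : x < n := hp.lt_of_parent_ne_zero (by rw [hM.parent x hx]; exact hu0)
  have hxu : x ≠ u := fun h => hp.ne_parent hu0 (h ▸ hM.parent x hx)
  rw [minDesc_insertAbove hp hu hM.parent hxu hxn]
  rcases desc_insertAbove_base hp hu0 hu (desc_minDesc (insertAbove p n u M) u) with
    h | ⟨c, hc, hcM, h⟩
  · rw [h]
    exact hM.twist x hx
  · by_contra hlt
    exact hcM (hM.down x hx c hc (h.minDesc_le.trans (not_lt.1 hlt)))

theorem Movable.ncard_twistSet (hp : IsParent n p) (hu0 : u ≠ 0) (hu : u < n)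
    (hM : Movable p u M) :
    (twistSet (insertAbove p n u M)).ncard = (twistSet p).ncard + 1 := by
  have hMlt : ∀ x ∈ M, x < n := fun x hx =>
    hp.lt_of_parent_ne_zero (by rw [hM.parent x hx]; exact hu0)
  have hMu : u ∉ M := fun h => hp.ne_parent hu0 (hM.parent u h)
  have hn : n ∉ twistSet p := fun h => (hp.twistSet_subset h).2.1.ne rfl
  have hnew : n ∈ twistSet (insertAbove p n u M) ↔ u ∈ twistSet p := by
    simp only [twistSet, Set.mem_ofPred_eq, insertAbove_new,
      minDesc_insertAbove_new hp hu hM.parent]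
  have hbase : u ∈ twistSet (insertAbove p n u M) := by
    simp only [twistSet, Set.mem_ofPred_eq, insertAbove_base p M hu]
    exact (minDesc_le_self _ u).trans_lt hu
  have hother : ∀ x, x ≠ n → x ≠ u → (x ∈ twistSet (insertAbove p n u M) ↔ x ∈ twistSet p) := by
    intro x hxn hxu
    simp only [twistSet, Set.mem_ofPred_eq]
    by_cases hxM : x ∈ M
    · rw [minDesc_insertAbove hp hu hM.parent hxu (hMlt x hxM), hM.parent x hxM,
        insertAbove_moved _ _ hxM (hMlt x hxM)]
      exact iff_of_true ((minDesc_le_self p x).trans_lt (hMlt x hxM)) (hM.twist x hxM)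
    · rw [insertAbove_of_not_mem _ hxn hxu hxM]
      by_cases hx : x < n
      · rw [minDesc_insertAbove hp hu hM.parent hxu hx]
      · simp [hp.out x (not_lt.1 hx)]
  by_cases htu : u ∈ twistSet p
  · rw [← Set.ncard_insert_of_notMem hn hp.finite_twistSet]
    congr 1
    ext x
    by_cases hxn : x = n
    · simp [hxn, hnew, htu]
    · by_cases hxu : x = u
      · simp [hxu, hbase, htu]
      · simp [hother x hxn hxu, hxn]
  · rw [← Set.ncard_insert_of_notMem htu hp.finite_twistSet]
    congr 1
    ext x
    by_cases hxn : x = n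
    · simp [hxn, hnew, htu, hn, hu.ne']
    · by_cases hxu : x = u
      · simp [hxu, hbase]
      · simp [hother x hxn hxu, hxu]

theorem Movable.insertAbove_inj {p' : ℕ → ℕ} {u' : ℕ} {M' : Set ℕ} (hp : IsParent n p)
    (hp' : IsParent n p') (hu0 : u ≠ 0) (hu : u < n) (hu0' : u' ≠ 0) (hu' : u' < n)
    (hM : Movable p u M) (hM' : Movable p' u' M')
    (h : insertAbove p n u M = insertAbove p' n u' M') : p = p' ∧ u = u' ∧ M = M' := by
  have hMlt : ∀ x ∈ M, x < n := fun x hx =>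
    hp.lt_of_parent_ne_zero (by rw [hM.parent x hx]; exact hu0)
  have hMlt' : ∀ x ∈ M', x < n := fun x hx =>
    hp'.lt_of_parent_ne_zero (by rw [hM'.parent x hx]; exact hu0')
  have hch : ∀ x, (x = u ∨ x ∈ M) ↔ (x = u' ∨ x ∈ M') := fun x => by
    rw [← insertAbove_eq_iff hp hu hMlt, h, insertAbove_eq_iff hp' hu' hMlt']
  have huu : u = u' := by
    by_contra hne
    have h1 : u' ∈ M := ((hch u').2 (Or.inl rfl)).resolve_left (Ne.symm hne)
    have h2 : u ∈ M' := ((hch u).1 (Or.inl rfl)).resolve_left hne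
    have h3 := hM.minDesc_lt hp hu0 hu h1
    have h4 := hM'.minDesc_lt hp' hu0' hu' h2
    rw [h] at h3
    exact h3.asymm h4
  subst huu
  have hMu : u ∉ M := fun h => hp.ne_parent hu0 (hM.parent u h)
  have hMu' : u ∉ M' := fun h => hp'.ne_parent hu0 (hM'.parent u h)
  have hMM : M = M' := by
    ext x
    by_cases hx : x = u
    · simp [hx, hMu, hMu']
    · simpa [hx] using hch x
  subst hMM
  refine ⟨funext fun x => ?_, rfl, rfl⟩
  by_cases hxn : x = n
  · rw [hp.out x hxn.ge, hp'.out x hxn.ge]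
  · by_cases hxu : x = u
    · have := congrFun h n
      rwa [insertAbove_new, insertAbove_new, ← hxu] at this
    · by_cases hxM : x ∈ M
      · rw [hM.parent x hxM, hM'.parent x hxM]
      · have := congrFun h x
        rwa [insertAbove_of_not_mem _ hxn hxu hxM, insertAbove_of_not_mem _ hxn hxu hxM] at this

end insertAbove

theorem IsParent.exists_addLeaf {n : ℕ} (hn : 0 < n) {q : ℕ → ℕ} (hq : IsParent (n + 1) q)
    (h : ∀ x, q x ≠ n) : ∃ p u, IsParent n p ∧ u < n ∧ addLeaf p n u = q := by
  have hlt : ∀ x, q x < n := fun x => (Nat.lt_succ_iff.1 (hq.lt x)).lt_of_ne (h x)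
  refine ⟨Function.update q n 0, q n, ⟨?_, fun v => ?_, fun v hv => ?_, ?_⟩, hlt n, ?_⟩
  · rw [Function.update_of_ne hn.ne, hq.zero]
  · by_cases hv : v = n
    · rwa [hv, Function.update_self]
    · rw [Function.update_of_ne hv]; exact hlt v
  · by_cases hv' : v = n
    · rw [hv', Function.update_self]
    · rw [Function.update_of_ne hv']; exact hq.out v (by omega)
  · obtain ⟨d, hd⟩ := hq.rank
    refine ⟨d, fun v hv => ?_⟩
    by_cases hv' : v = n
    · rw [hv', Function.update_self]
      exact (hq.rank_le hd (hq.zero_desc (q n))).trans_lt (hd n hn.ne')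
    · rw [Function.update_of_ne hv']
      exact hd v hv
  · simp [addLeaf]

theorem IsParent.exists_insertAbove {n : ℕ} (hn : 0 < n) {q : ℕ → ℕ} (hq : IsParent (n + 1) q)
    (h : ∃ x, q x = n) :
    ∃ p u M, IsParent n p ∧ u ≠ 0 ∧ u < n ∧ Movable p u M ∧ insertAbove p n u M = q := by
  classical
  have hlt : ∀ x, q x = n → x < n := fun x hx => by
    have h1 : x < n + 1 := hq.lt_of_parent_ne_zero (by omega)
    have h2 : x ≠ n := fun h => hq.ne_parent hn.ne' (h ▸ hx)
    omega
  have h0 : ∀ x, q x = n → x ≠ 0 := fun x hx hx0 => by rw [hx0, hq.zero] at hx; omega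
  have hfin : {x | q x = n}.Finite := (Set.finite_Iio n).subset fun x hx => hlt x hx
  obtain ⟨u, hu : q u = n, hmax⟩ := hfin.exists_maximalFor (minDesc q) _ h
  have hmax' : ∀ x, q x = n → x ≠ u → minDesc q x < minDesc q u := by
    intro x hx hxu
    rcases lt_or_ge (minDesc q x) (minDesc q u) with h | h
    · exact h
    · exact absurd (hq.sibling_inj (h0 x hx) (h0 u hu) (hx.trans hu.symm)
        ((hmax hx h).antisymm h)) hxu
  have hun := hlt u hu
  have hu0 := h0 u hu
  have hqn : q n < n := (Nat.lt_succ_iff.1 (hq.lt n)).lt_of_ne (hq.ne_parent hn.ne')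
  have hqnu : q n ≠ u := fun h => hq.not_desc_parent hn.ne'
    (Desc.step (by rw [h, hu]; exact Desc.refl))
  set p : ℕ → ℕ := fun x => if x = n then 0 else if x = u then q n else
    if q x = n then u else q x with hpdef
  set M : Set ℕ := {x | q x = n ∧ x ≠ u} with hMdef
  have hpM : ∀ x ∈ M, p x = u := by
    rintro x ⟨hx, hxu⟩
    simp [hpdef, hx, hxu, (hlt x hx).ne]
  have hp : IsParent n p := by
    refine ⟨?_, fun v => ?_, fun v hv => ?_, ?_⟩
    · have : q 0 ≠ n := by rw [hq.zero]; omega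
      simp [hpdef, hu0.symm, hq.zero, hn.ne]
    · have := hq.lt v
      simp only [hpdef]
      split_ifs <;> omega
    · simp only [hpdef]
      split_ifs with h1 h2 h3
      · rfl
      · omega
      · have := hlt v h3; omega
      · exact hq.out v (by omega)
    · obtain ⟨d, hd⟩ := hq.rank
      have hdn := hd n hn.ne'
      have hdu := hd u hu0
      rw [hu] at hdu
      refine ⟨Function.update d u (d n), fun v hv => ?_⟩
      have hdv := hd v hv
      simp only [hpdef]
      by_cases h1 : v = n
      · rw [if_pos h1, h1, Function.update_of_ne hu0.symm, Function.update_of_ne hun.ne']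
        exact (hq.rank_le hd (hq.zero_desc (q n))).trans_lt hdn
      · rw [if_neg h1]
        by_cases h2 : v = u
        · rw [if_pos h2, h2, Function.update_self, Function.update_of_ne hqnu]
          exact hdn
        · rw [if_neg h2, Function.update_of_ne h2]
          by_cases h3 : q v = n
          · rw [if_pos h3, Function.update_self]
            rwa [h3] at hdv
          · rw [if_neg h3]
            by_cases h4 : q v = u
            · rw [h4, Function.update_self]
              rw [h4] at hdv
              omega
            · rwa [Function.update_of_ne h4]
  have hins : insertAbove p n u M = q := by
    funext x
    simp only [insertAbove, hpdef, hMdef, Set.mem_ofPred_eq]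
    by_cases h1 : x = n
    · simp [h1, hun.ne]
    · by_cases h2 : x = u
      · simp [h2, hu, hun.ne]
      · by_cases h3 : q x = n <;> simp [h1, h2, h3]
  have hmin : ∀ x, x ≠ u → x < n → minDesc q x = minDesc p x := fun x hxu hx => by
    rw [← hins, minDesc_insertAbove hp hun hpM hxu hx]
  refine ⟨p, u, M, hp, hu0, hun, ⟨hpM, ?_, ?_⟩, hins⟩
  · rintro x ⟨hx, hxu⟩
    rw [← hmin x hxu (hlt x hx)]
    exact (hmax' x hx hxu).trans_le (minDesc_le_self q u)
  · rintro x ⟨hx, hxu⟩ y hy hyx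
    have hyu : y ≠ u := fun h => hp.ne_parent hu0 (h ▸ hy)
    have hyn : y < n := hp.lt_of_parent_ne_zero (by rw [hy]; exact hu0)
    refine ⟨?_, hyu⟩
    by_contra hqy
    have hqyu : q y = u := by simpa [hpdef, hyu, hyn.ne, hqy] using hy
    rw [← hmin x hxu (hlt x hx), ← hmin y hyu hyn] at hyx
    exact ((minDesc_le_of_parent hqyu).trans hyx).not_gt (hmax' x hx hxu)

/-- Each object of size `n` has `n + 1` extensions raising the statistic `s` by one,
`s` extensions raising it by two, and every object of size `n + 1` is one of these. -/
def HasGrowth (X : ℕ → Type) (s : ∀ n, X n → ℕ) : Prop :=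
  ∀ n, ∃ (S : X n → Type) (f : (Σ x : X n, Fin (n + 1) ⊕ S x) → X (n + 1)),
    (∀ x, Finite (S x) ∧ Nat.card (S x) = s n x) ∧ Function.Bijective f ∧
      (∀ x i, s (n + 1) (f ⟨x, Sum.inl i⟩) = s n x + 1) ∧
      ∀ x i, s (n + 1) (f ⟨x, Sum.inr i⟩) = s n x + 2

theorem HasGrowth.exists_equiv {X Y : ℕ → Type} {s : ∀ n, X n → ℕ} {t : ∀ n, Y n → ℕ}
    (hX : HasGrowth X s) (hY : HasGrowth Y t) (h0 : ∃ e : X 0 ≃ Y 0, ∀ x, t 0 (e x) = s 0 x)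
    (n : ℕ) : ∃ e : X n ≃ Y n, ∀ x, t n (e x) = s n x := by
  induction n with
  | zero => exact h0
  | succ n ih =>
    obtain ⟨e, he⟩ := ih
    obtain ⟨S, f, hS, hf, hf1, hf2⟩ := hX n
    obtain ⟨T, g, hT, hg, hg1, hg2⟩ := hY n
    have hST : ∀ x, Nonempty (S x ≃ T (e x)) := fun x => by
      have := (hS x).1
      have := (hT (e x)).1
      exact Finite.card_eq.1 (by rw [(hS x).2, (hT (e x)).2, he])
    let E : (Σ x : X n, Fin (n + 1) ⊕ S x) ≃ (Σ y : Y n, Fin (n + 1) ⊕ T y) :=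
      Equiv.sigmaCongr e fun x => Equiv.sumCongr (Equiv.refl _) (hST x).some
    refine ⟨(Equiv.ofBijective f hf).symm.trans (E.trans (Equiv.ofBijective g hg)), fun x => ?_⟩
    obtain ⟨⟨y, i | i⟩, rfl⟩ := hf.2 x
    · simp only [Equiv.trans_apply, Equiv.ofBijective_symm_apply_apply, Equiv.ofBijective_apply]
      rw [hf1, ← he y]
      exact hg1 _ _
    · simp only [Equiv.trans_apply, Equiv.ofBijective_symm_apply_apply, Equiv.ofBijective_apply]
      rw [hf2, ← he y]
      exact hg2 _ _

/-- The positions at which a new largest vertex can be inserted above existing vertices. -/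
abbrev InsertSlot (n : ℕ) (p : ℕ → ℕ) : Type := {u : ℕ // u ≠ 0 ∧ u < n} ⊕ twistSet p

/-- The vertex above which the new vertex is inserted. -/
def InsertSlot.base {n : ℕ} {p : ℕ → ℕ} : InsertSlot n p → ℕ
  | Sum.inl u => u
  | Sum.inr v => p v

/-- The vertices that are moved below the new vertex. -/
def InsertSlot.moved {n : ℕ} {p : ℕ → ℕ} : InsertSlot n p → Set ℕ
  | Sum.inl _ => ∅
  | Sum.inr v => {x | p x = p v ∧ minDesc p x ≤ minDesc p v}

theorem InsertSlot.finite_and_card {n : ℕ} {p : ℕ → ℕ} (hp : IsParent (n + 1) p) :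
    Finite (InsertSlot (n + 1) p) ∧ Nat.card (InsertSlot (n + 1) p) = n + (twistSet p).ncard := by
  have h1 : {u : ℕ | u ≠ 0 ∧ u < n + 1} = Finset.Icc 1 n := by
    ext u
    simp only [Set.mem_ofPred_eq, Finset.coe_Icc, Set.mem_Icc]
    omega
  have : Finite {u : ℕ // u ≠ 0 ∧ u < n + 1} :=
    Set.Finite.to_subtype (s := {u : ℕ | u ≠ 0 ∧ u < n + 1}) (h1 ▸ Finset.finite_toSet _)
  have := hp.finite_twistSet.to_subtype
  refine ⟨inferInstance, ?_⟩
  rw [Nat.card_sum, Nat.card_coe_set_eq]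
  congr 1
  change Nat.card ({u : ℕ | u ≠ 0 ∧ u < n + 1} : Set ℕ) = n
  rw [h1, Nat.card_coe_set_eq, Set.ncard_coe_finset]
  simp

theorem InsertSlot.base_mem {n : ℕ} {p : ℕ → ℕ} (hp : IsParent n p) (i : InsertSlot n p) :
    i.base ≠ 0 ∧ i.base < n := by
  rcases i with u | v
  · exact u.2
  · exact ⟨(hp.twistSet_subset v.2).2.2, hp.lt v⟩

theorem InsertSlot.movable {n : ℕ} {p : ℕ → ℕ} (i : InsertSlot n p) :
    Movable p i.base i.moved := by
  rcases i with u | v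
  · exact ⟨fun x h => h.elim, fun x h => h.elim, fun x h => h.elim⟩
  · exact ⟨fun x h => h.1, fun x h => h.2.trans_lt v.2, fun x h y hy hyx => ⟨hy, hyx.trans h.2⟩⟩

theorem InsertSlot.ext {n : ℕ} {p : ℕ → ℕ} (hp : IsParent n p) {i j : InsertSlot n p}
    (hb : i.base = j.base) (hm : i.moved = j.moved) : i = j := by
  rcases i with u | v <;> rcases j with u' | v'
  · exact congrArg Sum.inl (Subtype.ext hb)
  · have : (v' : ℕ) ∈ InsertSlot.moved (n := n) (Sum.inr v') := ⟨rfl, le_rfl⟩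
    rw [← hm] at this
    exact this.elim
  · have : (v : ℕ) ∈ InsertSlot.moved (n := n) (Sum.inr v) := ⟨rfl, le_rfl⟩
    rw [hm] at this
    exact this.elim
  · have h1 : (v : ℕ) ∈ InsertSlot.moved (n := n) (Sum.inr v) := ⟨rfl, le_rfl⟩
    have h2 : (v' : ℕ) ∈ InsertSlot.moved (n := n) (Sum.inr v') := ⟨rfl, le_rfl⟩
    rw [hm] at h1
    rw [← hm] at h2
    exact congrArg Sum.inr (Subtype.ext (hp.sibling_inj (hp.twistSet_subset v.2).1
      (hp.twistSet_subset v'.2).1 hb (h1.2.antisymm h2.2)))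

theorem Movable.exists_slot {n u : ℕ} {p : ℕ → ℕ} {M : Set ℕ} (hp : IsParent n p) (hu0 : u ≠ 0)
    (hu : u < n) (hM : Movable p u M) : ∃ i : InsertSlot n p, i.base = u ∧ i.moved = M := by
  rcases M.eq_empty_or_nonempty with rfl | hne
  · exact ⟨Sum.inl ⟨u, hu0, hu⟩, rfl, rfl⟩
  · have hfin : M.Finite := (Set.finite_Iio n).subset fun x hx =>
      hp.lt_of_parent_ne_zero (by rw [hM.parent x hx]; exact hu0)
    obtain ⟨v, hv, hmax⟩ := hfin.exists_maximalFor (minDesc p) _ hne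
    refine ⟨Sum.inr ⟨v, ?_⟩, hM.parent v hv, ?_⟩
    · change minDesc p v < p v
      rw [hM.parent v hv]
      exact hM.twist v hv
    · ext x
      refine ⟨fun h => hM.down v hv x (h.1.trans (hM.parent v hv)) h.2, fun h =>
        ⟨(hM.parent x h).trans (hM.parent v hv).symm, ?_⟩⟩
      exact (le_total (minDesc p x) (minDesc p v)).elim id fun h' => hmax h h'

theorem hasGrowth_isParent : HasGrowth (fun n => {p : ℕ → ℕ // IsParent (n + 1) p})
    (fun n p => n + (twistSet p.1).ncard) := by
  intro n
  refine ⟨fun p => InsertSlot (n + 1) p.1, fun a => match a with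
    | ⟨p, Sum.inl i⟩ => ⟨addLeaf p.1 (n + 1) i, isParent_addLeaf p.2 i.2⟩
    | ⟨p, Sum.inr i⟩ => ⟨insertAbove p.1 (n + 1) i.base i.moved,
        isParent_insertAbove p.2 (i.base_mem p.2).1 (i.base_mem p.2).2 i.movable.parent⟩,
    fun p => InsertSlot.finite_and_card p.2, ⟨?_, ?_⟩, ?_, ?_⟩
  · have hne : ∀ (p p' : ℕ → ℕ) (hp : IsParent (n + 1) p) (hp' : IsParent (n + 1) p')
        (u : Fin (n + 1)) (i : InsertSlot (n + 1) p'),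
        addLeaf p (n + 1) u ≠ insertAbove p' (n + 1) i.base i.moved := by
      intro p p' hp hp' u i h
      have h1 := congrFun h i.base
      rw [insertAbove_base _ _ (i.base_mem hp').2,
        addLeaf_of_ne _ _ (i.base_mem hp').2.ne] at h1
      exact (hp.lt i.base).ne h1
    rintro ⟨⟨p, hp⟩, i | i⟩ ⟨⟨p', hp'⟩, i' | i'⟩ h
    · have h : addLeaf p (n + 1) i = addLeaf p' (n + 1) i' := congrArg Subtype.val h
      have hi : i = i' := Fin.ext (by simpa only [addLeaf_self] using congrFun h (n + 1))
      have hpp : p = p' := by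
        funext x
        by_cases hx : x = n + 1
        · rw [hp.out x hx.ge, hp'.out x hx.ge]
        · simpa only [addLeaf_of_ne _ _ hx] using congrFun h x
      subst hi hpp
      rfl
    · exact absurd (congrArg Subtype.val h) (hne p p' hp hp' i i')
    · exact absurd (congrArg Subtype.val h).symm (hne p' p hp' hp i' i)
    · have h : insertAbove p (n + 1) i.base i.moved = insertAbove p' (n + 1) i'.base i'.moved :=
        congrArg Subtype.val h
      obtain ⟨rfl, h1, h2⟩ := Movable.insertAbove_inj hp hp' (i.base_mem hp).1 (i.base_mem hp).2
        (i'.base_mem hp').1 (i'.base_mem hp').2 i.movable i'.movable h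
      rw [InsertSlot.ext hp h1 h2]
  · rintro ⟨q, hq⟩
    by_cases h : ∃ x, q x = n + 1
    · obtain ⟨p, u, M, hp, hu0, hu, hM, rfl⟩ := hq.exists_insertAbove n.succ_pos h
      obtain ⟨i, rfl, rfl⟩ := hM.exists_slot hp hu0 hu
      exact ⟨⟨⟨p, hp⟩, Sum.inr i⟩, rfl⟩
    · obtain ⟨p, u, hp, hu, rfl⟩ := hq.exists_addLeaf n.succ_pos (not_exists.1 h)
      exact ⟨⟨⟨p, hp⟩, Sum.inl ⟨u, hu⟩⟩, rfl⟩
  · rintro ⟨p, hp⟩ i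
    change n + 1 + (twistSet (addLeaf p (n + 1) i)).ncard = _
    rw [twistSet_addLeaf hp i.2]
    exact Nat.add_right_comm _ _ _
  · rintro ⟨p, hp⟩ i
    change n + 1 + (twistSet (insertAbove p (n + 1) i.base i.moved)).ncard = _
    rw [i.movable.ncard_twistSet hp (i.base_mem hp).1 (i.base_mem hp).2]
    change _ = n + (twistSet p).ncard + 2
    omega

/-- The graph on `Fin (n + 1)` obtained from `G` by joining a new last vertex to `D`. -/
def extend {n : ℕ} (G : SimpleGraph (Fin n)) (D : Set (Fin n)) : SimpleGraph (Fin (n + 1)) where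
  Adj x y := (∃ a b, x = a.castSucc ∧ y = b.castSucc ∧ G.Adj a b) ∨
    (x = Fin.last n ∧ ∃ a ∈ D, y = a.castSucc) ∨ (y = Fin.last n ∧ ∃ a ∈ D, x = a.castSucc)
  symm := ⟨by
    rintro x y (⟨a, b, rfl, rfl, h⟩ | h | h)
    · exact Or.inl ⟨b, a, rfl, rfl, h.symm⟩
    · exact Or.inr (Or.inr h)
    · exact Or.inr (Or.inl h)⟩
  loopless := ⟨by
    rintro x (⟨a, b, rfl, h, h'⟩ | ⟨rfl, a, -, h⟩ | ⟨rfl, a, -, h⟩)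
    · exact h'.ne (Fin.castSucc_injective n h)
    · exact (Fin.castSucc_lt_last a).ne' h
    · exact (Fin.castSucc_lt_last a).ne' h⟩

section extend

variable {n : ℕ} (G : SimpleGraph (Fin n)) (D : Set (Fin n))

theorem extend_adj_castSucc (a b : Fin n) :
    (extend G D).Adj a.castSucc b.castSucc ↔ G.Adj a b := by
  simp [extend, (Fin.castSucc_lt_last _).ne]

theorem extend_adj_last (a : Fin n) : (extend G D).Adj (Fin.last n) a.castSucc ↔ a ∈ D := by
  simp [extend, (Fin.castSucc_lt_last _).ne, (Fin.castSucc_lt_last _).ne']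

theorem lowerNbrs_extend_last : lowerNbrs (extend G D) (Fin.last n) = Fin.castSucc '' D := by
  ext x
  refine Fin.lastCases ?_ (fun a => ?_) x
  · simp [lowerNbrs, (Fin.castSucc_lt_last _).ne]
  · simp [lowerNbrs, extend_adj_last, Fin.castSucc_lt_last]

theorem lowerNbrs_extend_castSucc (v : Fin n) :
    lowerNbrs (extend G D) v.castSucc = Fin.castSucc '' lowerNbrs G v := by
  ext x
  refine Fin.lastCases ?_ (fun a => ?_) x
  · simp [lowerNbrs, (Fin.castSucc_lt_last _).ne, (Fin.castSucc_lt_last _).le]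
  · simp [lowerNbrs, extend_adj_castSucc]

/-- A nonempty clique with at most two vertices. -/
def IsSmallClique (D : Set (Fin n)) : Prop :=
  D.Nonempty ∧ D.ncard ≤ 2 ∧ ∀ x ∈ D, ∀ y ∈ D, x ≠ y → G.Adj x y

theorem isSmallClique_extend_image (E : Set (Fin n)) :
    IsSmallClique (extend G D) (Fin.castSucc '' E) ↔ IsSmallClique G E := by
  simp only [IsSmallClique, Set.image_nonempty,
    Set.ncard_image_of_injective E (Fin.castSucc_injective n), Set.forall_mem_image,
    extend_adj_castSucc, ne_eq, (Fin.castSucc_injective n).eq_iff]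

theorem isIncreasing12Tree_extend (hn : 0 < n) :
    IsIncreasing12Tree (extend G D) ↔ IsIncreasing12Tree G ∧ IsSmallClique G D := by
  change (∀ v : Fin (n + 1), 1 ≤ v.val → IsSmallClique (extend G D) (lowerNbrs (extend G D) v)) ↔
    (∀ v : Fin n, 1 ≤ v.val → IsSmallClique G (lowerNbrs G v)) ∧ _
  rw [Fin.forall_fin_succ']
  simp only [lowerNbrs_extend_castSucc, lowerNbrs_extend_last, isSmallClique_extend_image,
    Fin.val_castSucc, Fin.val_last]
  rw [forall_prop_of_true (show 1 ≤ n from hn)]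

theorem extend_comap (G : SimpleGraph (Fin (n + 1))) :
    extend (G.comap Fin.castSucc) {a | G.Adj (Fin.last n) a.castSucc} = G := by
  ext x y
  refine Fin.lastCases ?_ (fun a => ?_) x <;> refine Fin.lastCases ?_ (fun b => ?_) y
  · simp
  · simp [extend_adj_last]
  · rw [SimpleGraph.adj_comm, extend_adj_last, SimpleGraph.adj_comm]
    rfl
  · simp [extend_adj_castSucc]

theorem extend_inj {G G' : SimpleGraph (Fin n)} {D D' : Set (Fin n)}
    (h : extend G D = extend G' D') : G = G' ∧ D = D' := by
  constructor
  · ext a b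
    rw [← extend_adj_castSucc G D, h, extend_adj_castSucc]
  · ext a
    rw [← extend_adj_last G D, h, extend_adj_last]

theorem edgeSet_extend : (extend G D).edgeSet =
    Sym2.map Fin.castSucc '' G.edgeSet ∪ (fun a : Fin n => s(Fin.last n, a.castSucc)) '' D := by
  ext e
  induction e with
  | _ x y =>
    rw [SimpleGraph.mem_edgeSet]
    constructor
    · rintro (⟨a, b, rfl, rfl, h⟩ | ⟨rfl, a, h, rfl⟩ | ⟨rfl, a, h, rfl⟩)
      · exact Or.inl ⟨s(a, b), h, rfl⟩
      · exact Or.inr ⟨a, h, rfl⟩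
      · exact Or.inr ⟨a, h, Sym2.eq_swap⟩
    · rintro (⟨e, he, h⟩ | ⟨a, ha, h⟩)
      · induction e with
        | _ a b =>
          rw [← SimpleGraph.mem_edgeSet, ← h]
          exact (extend_adj_castSucc G D a b).2 he
      · rw [← SimpleGraph.mem_edgeSet, ← h]
        exact (extend_adj_last G D a).2 ha

theorem ncard_edgeSet_extend :
    (extend G D).edgeSet.ncard = G.edgeSet.ncard + D.ncard := by
  rw [edgeSet_extend, Set.ncard_union_eq,
    Set.ncard_image_of_injective _ (Sym2.map.injective (Fin.castSucc_injective n)),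
    Set.ncard_image_of_injective]
  · intro a b h
    simpa [(Fin.castSucc_lt_last _).ne'] using h
  · rw [Set.disjoint_left]
    rintro _ ⟨e, -, rfl⟩ ⟨a, -, h⟩
    have : Fin.last n ∈ Sym2.map Fin.castSucc e := h ▸ Sym2.mem_mk_left _ _
    obtain ⟨b, -, hb⟩ := Sym2.mem_map.1 this
    exact (Fin.castSucc_lt_last b).ne hb

/-- The vertices to which a new vertex is attached. -/
def attachSet : Fin n ⊕ G.edgeSet → Set (Fin n)
  | Sum.inl u => {u}
  | Sum.inr e => {x | x ∈ (e : Sym2 (Fin n))}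

variable {G}

theorem exists_adj_attachSet (e : G.edgeSet) : ∃ a b, G.Adj a b ∧ (e : Sym2 (Fin n)) = s(a, b) ∧
    attachSet G (Sum.inr e) = {a, b} := by
  obtain ⟨e, he⟩ := e
  induction e with
  | _ a b =>
    refine ⟨a, b, he, rfl, ?_⟩
    ext x
    simp [attachSet]

theorem ncard_attachSet_edge (e : G.edgeSet) : (attachSet G (Sum.inr e)).ncard = 2 := by
  obtain ⟨a, b, h, -, h'⟩ := exists_adj_attachSet e
  rw [h', Set.ncard_pair h.ne]

theorem isSmallClique_attachSet (i : Fin n ⊕ G.edgeSet) : IsSmallClique G (attachSet G i) := by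
  rcases i with u | e
  · simp [attachSet, IsSmallClique]
  · obtain ⟨a, b, h, -, h'⟩ := exists_adj_attachSet e
    rw [h']
    refine ⟨Set.insert_nonempty _ _, (Set.ncard_pair h.ne).le, ?_⟩
    rintro x (rfl | rfl) y (rfl | rfl) hxy
    · exact absurd rfl hxy
    · exact h
    · exact h.symm
    · exact absurd rfl hxy

theorem attachSet_injective : Function.Injective (attachSet G) := by
  have hne : ∀ (u : Fin n) (e : G.edgeSet),
      attachSet G (Sum.inl u) ≠ attachSet G (Sum.inr e) := fun u e h => by
    have := ncard_attachSet_edge e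
    rw [← h, attachSet, Set.ncard_singleton] at this
    omega
  rintro (u | e) (u' | e') h
  · rw [Set.singleton_injective (show ({u} : Set (Fin n)) = {u'} from h)]
  · exact absurd h (hne _ _)
  · exact absurd h.symm (hne _ _)
  · refine congrArg Sum.inr (Subtype.ext (Sym2.ext fun x => ?_))
    exact Set.ext_iff.1 h x

theorem IsSmallClique.exists_attachSet {D : Set (Fin n)} (hD : IsSmallClique G D) :
    ∃ i, attachSet G i = D := by
  obtain ⟨h1, h2, h3⟩ := hD
  have h4 : 0 < D.ncard := (Set.ncard_pos (Set.toFinite D)).2 h1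
  obtain h | h : D.ncard = 1 ∨ D.ncard = 2 := by omega
  · obtain ⟨u, rfl⟩ := Set.ncard_eq_one.1 h
    exact ⟨Sum.inl u, rfl⟩
  · obtain ⟨a, b, hab, rfl⟩ := Set.ncard_eq_two.1 h
    refine ⟨Sum.inr ⟨s(a, b), h3 a (by simp) b (by simp) hab⟩, ?_⟩
    ext x
    simp [attachSet]

end extend

theorem hasGrowth_isIncreasing12Tree :
    HasGrowth (fun n => {G : SimpleGraph (Fin (n + 1)) // IsIncreasing12Tree G})
      (fun _ G => G.1.edgeSet.ncard) := by
  intro n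
  refine ⟨fun G => G.1.edgeSet, fun a => ⟨extend a.1.1 (attachSet a.1.1 a.2),
    (isIncreasing12Tree_extend _ _ n.succ_pos).2 ⟨a.1.2, isSmallClique_attachSet a.2⟩⟩,
    fun G => ⟨inferInstance, Nat.card_coe_set_eq _⟩, ⟨?_, ?_⟩, ?_, ?_⟩
  · rintro ⟨⟨G, hG⟩, i⟩ ⟨⟨G', hG'⟩, i'⟩ h
    obtain ⟨rfl, h⟩ : G = G' ∧ attachSet G i = attachSet G' i' :=
      extend_inj (congrArg Subtype.val h)
    obtain rfl : i = i' := attachSet_injective h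
    rfl
  · rintro ⟨G, hG⟩
    rw [← extend_comap G, isIncreasing12Tree_extend _ _ n.succ_pos] at hG
    obtain ⟨i, hi⟩ := hG.2.exists_attachSet
    exact ⟨⟨⟨_, hG.1⟩, i⟩, Subtype.ext ((congrArg (extend _) hi).trans (extend_comap G))⟩
  · rintro ⟨G, hG⟩ i
    simp only [ncard_edgeSet_extend, attachSet, Set.ncard_singleton]
  · rintro ⟨G, hG⟩ i
    simp only [ncard_edgeSet_extend, ncard_attachSet_edge]

/-- The tree on `Fin n` in which every vertex `v ≠ 0` is joined to `p v`. -/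
def parentGraph (n : ℕ) (p : ℕ → ℕ) : SimpleGraph (Fin n) where
  Adj x y := x ≠ y ∧ (p x = y ∨ p y = x)
  symm := ⟨fun _ _ h => ⟨h.1.symm, h.2.symm⟩⟩
  loopless := ⟨fun _ h => h.1 rfl⟩

/-- The edge from `v` to its parent. -/
def parentEdge {n : ℕ} {p : ℕ → ℕ} (hp : IsParent n p) (v : Fin n) : Sym2 (Fin n) :=
  s(v, ⟨p v, hp.lt v⟩)

section parentGraph

variable {n : ℕ} {p : ℕ → ℕ}

theorem IsParent.parent_parent_ne (hp : IsParent n p) {v : ℕ} (hv : v ≠ 0) : p (p v) ≠ v :=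
  fun h => hp.not_desc_parent hv (Desc.step (h.symm ▸ Desc.refl))

theorem parentGraph_adj_parent (hp : IsParent n p) {v : Fin n} (hv : v.val ≠ 0) :
    (parentGraph n p).Adj v ⟨p v, hp.lt v⟩ :=
  ⟨fun h => hp.ne_parent hv (congrArg Fin.val h).symm, Or.inl rfl⟩

theorem parentEdge_injOn (hp : IsParent n p) :
    Set.InjOn (parentEdge hp) {v | v.val ≠ 0} := by
  intro v hv v' _ h
  rcases Sym2.eq_iff.1 h with h | h
  · exact h.1
  · have h1 : v.val = p v' := congrArg Fin.val h.1
    have h2 : p v = v'.val := congrArg Fin.val h.2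
    exact absurd (by rw [h2, ← h1]) (hp.parent_parent_ne hv)

theorem edgeSet_parentGraph (hp : IsParent n p) :
    (parentGraph n p).edgeSet = parentEdge hp '' {v | v.val ≠ 0} := by
  have key : ∀ x y : Fin n, x ≠ y → p x = y → s(x, y) ∈ parentEdge hp '' {v | v.val ≠ 0} := by
    intro x y hne h
    refine ⟨x, fun h0 => hne (Fin.ext ?_), ?_⟩
    · rw [← h, h0, hp.zero]
    · rw [parentEdge, show (⟨p x, hp.lt x⟩ : Fin n) = y from Fin.ext h]
  ext e
  constructor
  · induction e with
    | _ x y =>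
      rintro ⟨hne, h | h⟩
      · exact key x y hne h
      · rw [Sym2.eq_swap]
        exact key y x hne.symm h
  · rintro ⟨v, hv, rfl⟩
    exact parentGraph_adj_parent hp hv

theorem reachable_of_desc (hp : IsParent n p) {H : SimpleGraph (Fin n)} {v w : Fin n}
    (hH : ∀ x : Fin n, x.val ≠ 0 → Desc p v (p x) → Desc p x w → H.Adj x ⟨p x, hp.lt x⟩)
    (h : Desc p v w) : H.Reachable v w := by
  have key : ∀ y, Desc p v y → Desc p y w → ∀ hy : y < n, H.Reachable v ⟨y, hy⟩ := by
    intro y hvy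
    induction hvy with
    | refl => exact fun _ _ => SimpleGraph.Reachable.refl _
    | @step y hvy ih =>
      intro hyw hy
      have ih := ih ((Desc.step Desc.refl).trans hyw) (hp.lt y)
      by_cases h0 : y = 0
      · have : p y = y := by rw [h0, hp.zero]
        simpa only [this] using ih
      · exact ih.trans (hH ⟨y, hy⟩ h0 hvy hyw).symm.reachable
  exact key w h Desc.refl w.2

theorem reachable_deleteEdges_parentEdge_iff (hp : IsParent n p) {v w : Fin n}
    (hv : v.val ≠ 0) :
    ((parentGraph n p).deleteEdges {parentEdge hp v}).Reachable v w ↔ Desc p v w := by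
  constructor
  · intro h
    rw [SimpleGraph.reachable_iff_reflTransGen] at h
    induction h with
    | refl => exact Desc.refl
    | @tail x y _ hxy ih =>
      obtain ⟨⟨-, h | h⟩, hne⟩ := SimpleGraph.deleteEdges_adj.1 hxy
      · rcases ih.cases_parent with h' | h'
        · refine absurd ?_ hne
          obtain rfl : x = v := Fin.ext h'
          rw [Set.mem_singleton_iff, parentEdge, show (⟨p x, hp.lt x⟩ : Fin n) = y from Fin.ext h]
        · exact h ▸ h'
      · exact Desc.step (h.symm ▸ ih)
  · refine reachable_of_desc hp fun x hx hvx _ => ?_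
    refine SimpleGraph.deleteEdges_adj.2 ⟨parentGraph_adj_parent hp hx, fun h => ?_⟩
    have hxv : x = v := parentEdge_injOn hp hx hv h
    subst hxv
    exact hp.not_desc_parent hx hvx

theorem subtreeSet_parentGraph (hp : IsParent n p) {u v : Fin n} (hv : v.val ≠ 0)
    (huv : p v = u) : subtreeSet (parentGraph n p) u v = {w : Fin n | Desc p v w} := by
  ext w
  have : s(u, v) = parentEdge hp v := by
    rw [parentEdge, show (⟨p v, hp.lt v⟩ : Fin n) = u from Fin.ext huv, Sym2.eq_swap]
  rw [subtreeSet, Set.mem_ofPred_eq, this, reachable_deleteEdges_parentEdge_iff hp hv,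
    Set.mem_ofPred_eq]

theorem isChild_parentGraph_iff (hp : IsParent n p) {r u v : Fin n} (hr : r.val = 0) :
    IsChild (parentGraph n p) r u v ↔ v.val ≠ 0 ∧ p v = u := by
  constructor
  · rintro ⟨⟨hne, h⟩, hnr⟩
    by_cases hvu : p v = u
    · refine ⟨fun h0 => hne (Fin.ext ?_), hvu⟩
      rw [← hvu, h0, hp.zero]
    · exfalso
      have huv : p u = v := h.resolve_right hvu
      have hu0 : u.val ≠ 0 := fun h0 => hne (Fin.ext (by rw [← huv, h0, hp.zero]))
      have he : s(u, v) = parentEdge hp u := by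
        rw [parentEdge, show (⟨p u, hp.lt u⟩ : Fin n) = v from Fin.ext huv]
      refine hnr (reachable_of_desc hp (fun x hx _ hxv => ?_) (hr ▸ hp.zero_desc v))
      refine SimpleGraph.deleteEdges_adj.2 ⟨parentGraph_adj_parent hp hx, fun h => ?_⟩
      rw [he] at h
      have hxu : x = u := parentEdge_injOn hp hx hu0 h
      subst hxu
      rw [← huv] at hxv
      exact hp.not_desc_parent hx hxv
  · rintro ⟨hv, huv⟩
    have hu : (⟨p v, hp.lt v⟩ : Fin n) = u := Fin.ext huv
    refine ⟨hu ▸ (parentGraph_adj_parent hp hv).symm, fun h => ?_⟩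
    have h' : r ∈ subtreeSet (parentGraph n p) u v := h.symm
    rw [subtreeSet_parentGraph hp hv huv] at h'
    exact hv (hp.desc_zero h' hr)

theorem minLabel_subtreeSet_parentGraph (hp : IsParent n p) {u v : Fin n} (hv : v.val ≠ 0)
    (huv : p v = u) : minLabel (subtreeSet (parentGraph n p) u v) = minDesc p v := by
  rw [subtreeSet_parentGraph hp hv huv, minLabel, minDesc]
  congr 1
  ext w
  constructor
  · rintro ⟨w, hw, rfl⟩
    exact hw
  · exact fun hw => ⟨⟨w, hp.desc_lt hw hv v.2⟩, hw, rfl⟩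

theorem numTwists_parentGraph (hp : IsParent n p) {r : Fin n} (hr : r.val = 0) :
    numTwists (parentGraph n p) r = (twistSet p).ncard := by
  have h1 : {e | e ∈ (parentGraph n p).edgeSet ∧ IsTwist (parentGraph n p) r e} =
      parentEdge hp '' {v | v.val ∈ twistSet p} := by
    ext e
    constructor
    · rintro ⟨-, u, v, rfl, hc, hlt⟩
      obtain ⟨hv, huv⟩ := (isChild_parentGraph_iff hp hr).1 hc
      rw [minLabel_subtreeSet_parentGraph hp hv huv, ← huv] at hlt
      refine ⟨v, hlt, ?_⟩
      rw [parentEdge, show (⟨p v, hp.lt v⟩ : Fin n) = u from Fin.ext huv, Sym2.eq_swap]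
    · rintro ⟨v, hv, rfl⟩
      have hv0 := (hp.twistSet_subset hv).1
      refine ⟨parentGraph_adj_parent hp hv0, ⟨p v, hp.lt v⟩, v, Sym2.eq_swap,
        (isChild_parentGraph_iff hp hr).2 ⟨hv0, rfl⟩, ?_⟩
      rw [minLabel_subtreeSet_parentGraph hp hv0 rfl]
      exact hv
  have h2 : twistSet p = Fin.val '' {v : Fin n | v.val ∈ twistSet p} := by
    ext v
    constructor
    · exact fun hv => ⟨⟨v, (hp.twistSet_subset hv).2.1⟩, hv, rfl⟩
    · rintro ⟨v, hv, rfl⟩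
      exact hv
  change Nat.card ({e | e ∈ (parentGraph n p).edgeSet ∧ IsTwist (parentGraph n p) r e} :
    Set (Sym2 (Fin n))) = _
  have hinj : Set.InjOn (parentEdge hp) {v | v.val ∈ twistSet p} :=
    (parentEdge_injOn hp).mono fun v hv => (hp.twistSet_subset hv).1
  rw [Nat.card_coe_set_eq, h1, hinj.ncard_image,
    ← Set.ncard_image_of_injective _ Fin.val_injective, ← h2]

theorem isTree_parentGraph {p : ℕ → ℕ} (hp : IsParent (n + 1) p) :
    (parentGraph (n + 1) p).IsTree := by
  rw [SimpleGraph.isTree_iff_connected_and_card]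
  constructor
  · have h : ∀ v, (parentGraph (n + 1) p).Reachable 0 v := fun v =>
      reachable_of_desc hp (fun x hx _ _ => parentGraph_adj_parent hp hx) (hp.zero_desc v)
    exact ⟨fun u v => (h u).symm.trans (h v)⟩
  · rw [Nat.card_coe_set_eq, edgeSet_parentGraph hp,
      (parentEdge_injOn hp).ncard_image]
    have : {v : Fin (n + 1) | v.val ≠ 0} = {0}ᶜ := by
      ext v
      exact not_congr Fin.val_eq_zero_iff
    rw [this, Set.ncard_compl, Set.ncard_singleton, Nat.card_fin]
    rfl

theorem parentGraph_injective {p q : ℕ → ℕ} (hp : IsParent n p) (hq : IsParent n q)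
    (h : parentGraph n p = parentGraph n q) : p = q := by
  obtain ⟨d, hd⟩ := hp.rank
  funext v
  induction hk : d v using Nat.strong_induction_on generalizing v with
  | _ k ih =>
    by_cases hv : v = 0
    · rw [hv, hp.zero, hq.zero]
    · by_cases hvn : v < n
      · have hadj : (parentGraph n p).Adj ⟨v, hvn⟩ ⟨p v, hp.lt v⟩ := parentGraph_adj_parent hp hv
        rw [h] at hadj
        rcases hadj.2 with h' | h'
        · exact h'.symm
        · have := ih _ (hk ▸ hd v hv) (p v) rfl
          exact absurd (this.trans h') (hp.parent_parent_ne hv)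
      · rw [hp.out v (not_lt.1 hvn), hq.out v (not_lt.1 hvn)]

theorem exists_parentGraph_eq {G : SimpleGraph (Fin (n + 1))} (hG : G.IsTree) :
    ∃ p, IsParent (n + 1) p ∧ parentGraph (n + 1) p = G := by
  have hex : ∀ v : Fin (n + 1), ∃ w, v ≠ 0 → G.Adj v w ∧ G.dist w 0 < G.dist v 0 := by
    intro v
    by_cases hv : v = 0
    · exact ⟨0, fun h => absurd hv h⟩
    · obtain ⟨W, hW⟩ := hG.connected.exists_walk_length_eq_dist v 0
      cases W with
      | nil => exact absurd rfl hv
      | @cons _ w _ h W =>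
        refine ⟨w, fun _ => ⟨h, ?_⟩⟩
        rw [SimpleGraph.Walk.length_cons] at hW
        have := SimpleGraph.dist_le W
        omega
  choose f hf using hex
  let p : ℕ → ℕ := fun v => if h : v < n + 1 ∧ v ≠ 0 then f ⟨v, h.1⟩ else 0
  have hpf : ∀ v : Fin (n + 1), v ≠ 0 → p v = f v := fun v hv =>
    dif_pos ⟨v.2, fun h => hv (Fin.ext h)⟩
  have hp : IsParent (n + 1) p := by
    refine ⟨dif_neg fun h => h.2 rfl, fun v => ?_, fun v hv => dif_neg fun h => hv.not_gt h.1,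
      fun v => if h : v < n + 1 then G.dist ⟨v, h⟩ 0 else 1, fun v hv => ?_⟩
    · by_cases h : v < n + 1 ∧ v ≠ 0
      · simp only [p, dif_pos h]
        exact (f _).2
      · simp only [p, dif_neg h]
        exact n.succ_pos
    · by_cases hvn : v < n + 1
      · have hv' : (⟨v, hvn⟩ : Fin (n + 1)) ≠ 0 := fun h => hv (congrArg Fin.val h)
        have hpv : p v = f ⟨v, hvn⟩ := hpf ⟨v, hvn⟩ hv'
        simp only [hpv, dif_pos hvn, dif_pos (f ⟨v, hvn⟩).2]
        exact (hf _ hv').2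
      · have hpv : p v = 0 := dif_neg fun h => hvn h.1
        simp only [hpv, dif_neg hvn, dif_pos n.succ_pos]
        have : G.dist ⟨0, n.succ_pos⟩ 0 = 0 := SimpleGraph.dist_self
        omega
  have hle : parentGraph (n + 1) p ≤ G := by
    have key : ∀ x y : Fin (n + 1), x ≠ y → p x = y → G.Adj x y := by
      intro x y hne h
      have hx : x ≠ 0 := by
        rintro rfl
        exact hne (Fin.ext (h.symm.trans hp.zero).symm)
      have hy : f x = y := Fin.ext ((hpf x hx).symm.trans h)
      exact hy ▸ (hf x hx).1
    rintro x y ⟨hne, h | h⟩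
    · exact key x y hne h
    · exact (key y x hne.symm h).symm
  exact ⟨p, hp, hle.antisymm
    ((SimpleGraph.isTree_iff_minimal_connected.1 hG).2 (isTree_parentGraph hp).connected hle)⟩

end parentGraph

theorem numCayleyTwist_eq (n j : ℕ) (h : 0 < n + 1) : numCayleyTwist (n + 1) j h =
    Nat.card {p : {p : ℕ → ℕ // IsParent (n + 1) p} // n + (twistSet p.1).ncard = n + j} := by
  symm
  refine Nat.card_congr (Equiv.ofBijective
    (fun p => ⟨parentGraph (n + 1) p.1.1, isTree_parentGraph p.1.2,
      (numTwists_parentGraph p.1.2 rfl).trans (Nat.add_left_cancel p.2)⟩) ⟨?_, ?_⟩)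
  · rintro ⟨⟨p, hp⟩, _⟩ ⟨⟨q, hq⟩, _⟩ hpq
    exact Subtype.ext (Subtype.ext (parentGraph_injective hp hq (congrArg Subtype.val hpq)))
  · rintro ⟨G, hG, hj⟩
    obtain ⟨p, hp, rfl⟩ := exists_parentGraph_eq hG
    rw [numTwists_parentGraph hp rfl] at hj
    exact ⟨⟨⟨p, hp⟩, congrArg (n + ·) hj⟩, rfl⟩

theorem numInc12Trees_eq (n m : ℕ) : numInc12Trees n m =
    Nat.card {G : {G : SimpleGraph (Fin n) // IsIncreasing12Tree G} // G.1.edgeSet.ncard = m} :=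
  Nat.card_congr (Equiv.subtypeSubtypeEquivSubtypeInter _ _).symm

theorem exists_equiv_isParent_one :
    ∃ e : {G : SimpleGraph (Fin 1) // IsIncreasing12Tree G} ≃
        {p : ℕ → ℕ // IsParent 1 p},
      ∀ G, 0 + (twistSet (e G).1).ncard = G.1.edgeSet.ncard := by
  have hp : ∀ p : ℕ → ℕ, IsParent 1 p → p = fun _ => 0 := fun p h =>
    funext fun v => Nat.lt_one_iff.1 (h.lt v)
  let X : Unique {G : SimpleGraph (Fin 1) // IsIncreasing12Tree G} :=
    ⟨⟨⟨⊥, fun v hv => by omega⟩⟩, fun G => Subtype.ext (Subsingleton.elim _ _)⟩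
  let Y : Unique {p : ℕ → ℕ // IsParent 1 p} :=
    ⟨⟨⟨fun _ => 0, rfl, fun _ => Nat.one_pos, fun _ _ => rfl, id, fun _ => Nat.pos_of_ne_zero⟩⟩,
      fun p => Subtype.ext (hp _ p.2)⟩
  refine ⟨Equiv.ofUnique _ _, fun G => ?_⟩
  have h1 : G.1 = ⊥ := Subsingleton.elim _ _
  have h2 : ∀ p : {p : ℕ → ℕ // IsParent 1 p}, twistSet p.1 = ∅ := fun p => by
    rw [hp _ p.2]
    simp [twistSet]
  rw [h1, h2]
  simp

/-- For every `n ≥ 1` and `j ≥ 0`, the number of increasing 1,2-trees on `{1,…,n}` with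
`(n-1)+j` edges equals the number of Cayley trees on `{1,…,n}` with exactly `j` twists. -/
theorem increasing12Trees_eq_cayleyTrees_twists :
    ∀ n : ℕ, ∀ hn : 1 ≤ n, ∀ j : ℕ,
      numInc12Trees n ((n - 1) + j) = numCayleyTwist n j hn := by
  rintro (_ | n) hn j
  · omega
  · obtain ⟨e, he⟩ := hasGrowth_isIncreasing12Tree.exists_equiv hasGrowth_isParent
      exists_equiv_isParent_one n
    rw [numCayleyTwist_eq, numInc12Trees_eq, Nat.add_sub_cancel]
    exact Nat.card_congr (e.subtypeEquiv fun G => by rw [← he G])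
end

section
/- For every integer n ≥ 2, the number of increasing 1,2-trees on the vertex set {1,…,n} equals n^(n−2). -/
open SimpleGraph

open Finset

/-- The graph on `Fin (n + 1)` obtained from `G` by adding a last vertex with neighborhood `D`. -/
def addLast {n : ℕ} (G : SimpleGraph (Fin n)) (D : Finset (Fin n)) :
    SimpleGraph (Fin (n + 1)) where
  Adj a b := (∃ x y, a = Fin.castSucc x ∧ b = Fin.castSucc y ∧ G.Adj x y) ∨
    (∃ x ∈ D, a = Fin.castSucc x ∧ b = Fin.last n) ∨
    (∃ x ∈ D, b = Fin.castSucc x ∧ a = Fin.last n)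
  symm := ⟨by
    rintro a b (⟨x, y, hx, hy, h⟩ | h | h)
    · exact .inl ⟨y, x, hy, hx, h.symm⟩
    · exact .inr (.inr h)
    · exact .inr (.inl h)⟩
  loopless := ⟨by
    rintro a (⟨x, y, hx, hy, h⟩ | ⟨x, _, hx, hy⟩ | ⟨x, _, hx, hy⟩)
    · exact h.ne (Fin.castSucc_injective _ (hx ▸ hy))
    · exact (Fin.castSucc_lt_last x).ne (hx ▸ hy)
    · exact (Fin.castSucc_lt_last x).ne (hx ▸ hy)⟩

section addLast

variable {n : ℕ} (G : SimpleGraph (Fin n)) (D : Finset (Fin n))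

@[simp]
lemma addLast_adj_castSucc_castSucc (x y : Fin n) :
    (addLast G D).Adj x.castSucc y.castSucc ↔ G.Adj x y := by
  simp [addLast, Fin.castSucc_ne_last]

@[simp]
lemma addLast_adj_castSucc_last (x : Fin n) :
    (addLast G D).Adj x.castSucc (Fin.last n) ↔ x ∈ D := by
  simp [addLast, Fin.castSucc_ne_last, (Fin.castSucc_ne_last _).symm]

@[simp]
lemma addLast_adj_last_castSucc (x : Fin n) :
    (addLast G D).Adj (Fin.last n) x.castSucc ↔ x ∈ D := by
  rw [SimpleGraph.adj_comm, addLast_adj_castSucc_last]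

lemma lowerNbrs_addLast_castSucc (v : Fin n) :
    lowerNbrs (addLast G D) v.castSucc = Fin.castSucc '' lowerNbrs G v := by
  ext a
  cases a using Fin.lastCases with
  | last => simp [lowerNbrs, Fin.castSucc_ne_last, (Fin.castSucc_lt_last v).le]
  | cast x => simp [lowerNbrs]

lemma lowerNbrs_addLast_last :
    lowerNbrs (addLast G D) (Fin.last n) = Fin.castSucc '' (D : Set (Fin n)) := by
  ext a
  cases a using Fin.lastCases with
  | last => simp [lowerNbrs, Fin.castSucc_ne_last]
  | cast x => simp [lowerNbrs, Fin.castSucc_lt_last]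

lemma isIncreasing12Tree_addLast_iff (hn : 1 ≤ n) :
    IsIncreasing12Tree (addLast G D) ↔
      IsIncreasing12Tree G ∧ D.Nonempty ∧ #D ≤ 2 ∧ ∀ x ∈ D, ∀ y ∈ D, x ≠ y → G.Adj x y := by
  rw [IsIncreasing12Tree, Fin.forall_fin_succ']
  simp [lowerNbrs_addLast_castSucc, lowerNbrs_addLast_last, IsIncreasing12Tree, hn,
    Set.ncard_image_of_injective _ (Fin.castSucc_injective n)]

end addLast

open Classical in
/-- A graph on `Fin (n + 1)` amounts to its restriction to `Fin n` and the neighborhood of the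
last vertex. -/
noncomputable def addLastEquiv (n : ℕ) :
    SimpleGraph (Fin n) × Finset (Fin n) ≃ SimpleGraph (Fin (n + 1)) where
  toFun p := addLast p.1 p.2
  invFun H := (H.comap Fin.castSucc, univ.filter fun x => H.Adj (Fin.last n) x.castSucc)
  left_inv p := by
    ext <;> simp
  right_inv H := by
    ext a b
    cases a using Fin.lastCases <;> cases b using Fin.lastCases <;> simp [SimpleGraph.adj_comm]

open Classical in
/-- The edges of `G`, as pairs ordered by label. -/
noncomputable def orderedEdges {n : ℕ} (G : SimpleGraph (Fin n)) : Finset (Fin n × Fin n) :=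
  {p | p.1 < p.2 ∧ G.Adj p.1 p.2}

lemma card_orderedEdges_addLast {n : ℕ} (G : SimpleGraph (Fin n)) (D : Finset (Fin n)) :
    #(orderedEdges (addLast G D)) = #(orderedEdges G) + #D := by
  classical
  simp only [orderedEdges, card_filter, Fintype.sum_prod_type_right, Fin.sum_univ_castSucc]
  simp [sum_add_distrib,
    Fin.castSucc_lt_last, (Fin.castSucc_lt_last _).le]

open Classical in
/-- The nonempty cliques with at most two vertices. -/
noncomputable def smallCliques {n : ℕ} (G : SimpleGraph (Fin n)) : Finset (Finset (Fin n)) :=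
  {D | D.Nonempty ∧ #D ≤ 2 ∧ ∀ x ∈ D, ∀ y ∈ D, x ≠ y → G.Adj x y}

lemma sum_smallCliques {n : ℕ} (G : SimpleGraph (Fin n)) (f : ℕ → ℤ) :
    ∑ D ∈ smallCliques G, f #D = n * f 1 + #(orderedEdges G) * f 2 := by
  classical
  have hU : smallCliques G = univ.image (fun x => {x}) ∪
      (orderedEdges G).image (fun p => {p.1, p.2}) := by
    ext D
    simp only [smallCliques, orderedEdges, mem_filter, mem_univ, true_and, mem_union, mem_image,
      Prod.exists]
    constructor
    · rintro ⟨h0, h2, hc⟩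
      have : #D = 1 ∨ #D = 2 := by have := h0.card_pos; omega
      rcases this with h | h
      · obtain ⟨x, rfl⟩ := card_eq_one.1 h
        exact .inl ⟨x, rfl⟩
      · obtain ⟨x, y, hxy, rfl⟩ := card_eq_two.1 h
        have := hc x (by simp) y (by simp) hxy
        rcases lt_or_gt_of_ne hxy with hlt | hlt
        · exact .inr ⟨x, y, ⟨hlt, this⟩, rfl⟩
        · exact .inr ⟨y, x, ⟨hlt, this.symm⟩, pair_comm _ _⟩
    · rintro (⟨x, rfl⟩ | ⟨x, y, ⟨hlt, h⟩, rfl⟩)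
      · simp
      · simp [card_le_two, h, h.symm]
  have hcard : ∀ p ∈ orderedEdges G, #({p.1, p.2} : Finset (Fin n)) = 2 := by
    intro p hp
    exact card_pair (mem_filter.1 hp).2.1.ne
  rw [hU, sum_union, sum_image, sum_image,
    sum_congr (s₁ := orderedEdges G) rfl fun p hp => by rw [hcard p hp]]
  · simp
  · rintro ⟨a, b⟩ hp ⟨c, d⟩ hq h
    simp only [orderedEdges, coe_filter, mem_univ, true_and, Set.mem_ofPred_eq] at hp hq
    have hl := Finset.ext_iff.1 h
    simp only [mem_insert, mem_singleton] at hl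
    have h1 := hl a
    have h2 := hl b
    have h3 := hl c
    have h4 := hl d
    ext <;> grind
  · simp [Set.InjOn]
  · rw [Finset.disjoint_left]
    intro D h1 h2
    obtain ⟨x, -, rfl⟩ := mem_image.1 h1
    obtain ⟨p, hp, h⟩ := mem_image.1 h2
    have := hcard p hp
    rw [h] at this
    simp at this

open Classical in
/-- The sum of `f m` over the increasing 1,2-trees on `n` vertices, `m` being the number
of edges. -/
noncomputable def edgeSum (n : ℕ) (f : ℕ → ℤ) : ℤ :=
  ∑ G : SimpleGraph (Fin n) with IsIncreasing12Tree G, f #(orderedEdges G)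

lemma edgeSum_succ {n : ℕ} (hn : 1 ≤ n) (f : ℕ → ℤ) :
    edgeSum (n + 1) f = edgeSum n fun m => n * f (m + 1) + m * f (m + 2) := by
  classical
  rw [edgeSum, edgeSum, sum_filter, ← (addLastEquiv n).sum_comp, Fintype.sum_prod_type, sum_filter]
  refine sum_congr rfl fun G _ => ?_
  simp only [addLastEquiv, Equiv.coe_fn_mk, isIncreasing12Tree_addLast_iff _ _ hn,
    card_orderedEdges_addLast]
  split_ifs with h
  · rw [← sum_smallCliques G fun d => f (#(orderedEdges G) + d), smallCliques, sum_filter]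
    simp [h]
  · simp [h]

lemma edgeSum_one (f : ℕ → ℤ) : edgeSum 1 f = f 0 := by
  classical
  have h (G : SimpleGraph (Fin 1)) : IsIncreasing12Tree G := fun v hv => by omega
  have h0 (G : SimpleGraph (Fin 1)) : orderedEdges G = ∅ := by
    ext ⟨a, b⟩
    simp [orderedEdges, Subsingleton.elim a b]
  simp [edgeSum, h, h0]

lemma edgeSum_two (f : ℕ → ℤ) : edgeSum 2 f = f 1 := by
  rw [edgeSum_succ le_rfl, edgeSum_one]
  simp

lemma edgeSum_ascFactorial_succ {n : ℕ} (hn : 1 ≤ n) (l : ℕ) :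
    edgeSum (n + 1) (fun m => m.ascFactorial (l + 1)) =
      (l + 1) * edgeSum (n + 1) (fun m => m.ascFactorial l) +
        n * edgeSum n (fun m => m.ascFactorial (l + 1)) +
        edgeSum n (fun m => m.ascFactorial (l + 2)) := by
  simp only [edgeSum_succ hn]
  simp only [edgeSum, mul_sum, ← sum_add_distrib]
  refine sum_congr rfl fun G _ => ?_
  generalize #(orderedEdges G) = m
  have h1 : (m : ℤ) * (m + 1).ascFactorial l = (m + l) * m.ascFactorial l := by
    exact_mod_cast Nat.succ_ascFactorial m l
  have h2 : (m + 1 : ℤ) * (m + 2).ascFactorial l = (m + 1 + l) * (m + 1).ascFactorial l := by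
    exact_mod_cast Nat.succ_ascFactorial (m + 1) l
  simp only [Nat.ascFactorial_succ]
  push_cast
  linear_combination m * h2 + (n + m + l + 1) * h1

lemma edgeSum_ascFactorial_zero {n : ℕ} (hn : 1 ≤ n) :
    edgeSum (n + 1) (fun m => m.ascFactorial 0) =
      n * edgeSum n (fun m => m.ascFactorial 0) + edgeSum n (fun m => m.ascFactorial 1) := by
  rw [edgeSum_succ hn]
  simp only [edgeSum, mul_sum, ← sum_add_distrib]
  simp [Nat.ascFactorial]

lemma fwdDiff_iter_succ_id_mul (f : ℤ → ℤ) (l : ℕ) (x : ℤ) :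
    (fwdDiff 1)^[l + 1] (fun y => y * f y) x =
      x * (fwdDiff 1)^[l + 1] f x + (l + 1) * (fwdDiff 1)^[l] f (x + 1) := by
  induction l generalizing x with
  | zero => simp [fwdDiff]; ring
  | succ l ih =>
    rw [Function.iterate_succ_apply', fwdDiff, ih, ih, Function.iterate_succ_apply' _ (l + 1),
      fwdDiff, Function.iterate_succ_apply' _ l f, fwdDiff, fwdDiff]
    push_cast
    ring

lemma edgeSum_ascFactorial (k l : ℕ) :
    edgeSum (k + 2) (fun m => m.ascFactorial l) =
      (fwdDiff 1)^[l] (fun y : ℤ => y ^ (k + l)) (k + 2) := by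
  induction k generalizing l with
  | zero =>
    rw [edgeSum_two]
    simp [fwdDiff_iter_eq_factorial]
  | succ k ih =>
    induction l with
    | zero =>
      rw [edgeSum_ascFactorial_zero (by omega), ih, ih]
      simp only [Function.iterate_zero, id, Function.iterate_one, fwdDiff]
      push_cast
      ring
    | succ l ihl =>
      have hL := fwdDiff_iter_succ_id_mul (fun y => y ^ (k + (l + 1))) l (k + 2)
      simp only [← pow_succ'] at hL
      rw [edgeSum_ascFactorial_succ (by omega), ihl, ih, ih, Function.iterate_succ_apply' _ (l + 1),
        fwdDiff]
      rw [show k + (l + 2) = k + (l + 1) + 1 by ring, show k + 1 + (l + 1) = k + (l + 1) + 1 by ring,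
        show k + 1 + l = k + (l + 1) by ring, hL]
      push_cast
      rw [show (k + 1 + 2 : ℤ) = k + 2 + 1 by ring]
      ring

/-- For every `n ≥ 2`, the number of increasing 1,2-trees on `{1,…,n}` is `n ^ (n-2)`. -/
theorem card_increasing12Trees (n : ℕ) (hn : 2 ≤ n) :
    Nat.card {G : SimpleGraph (Fin n) // IsIncreasing12Tree G} = n ^ (n - 2) := by
  classical
  obtain ⟨k, rfl⟩ := Nat.exists_eq_add_of_le' hn
  have := edgeSum_ascFactorial k 0
  simp only [edgeSum, Nat.ascFactorial_zero, Nat.cast_one, sum_const, Function.iterate_zero, id,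
    nsmul_eq_mul, mul_one, add_zero] at this
  rw [Nat.card_eq_fintype_card, Fintype.card_subtype]
  exact_mod_cast this
end
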